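/- Let a > 0 and let Ω ⊂ ℝ² be the Bunimovich stadium with parameter a, with rectangular part R = (0,1) × (0,a). Let α : closure(Ω) → ℝ be a continuous function with α(p) = 1 for every p ∈ Ω ∖ R. Then there exists a constant C > 0 such that for every λ ∈ ℝ and every function u : ℝ² → ℂ that is twice continuously differentiable on the closure of Ω, vanishes on the boundary of Ω, and satisfies −Δu = λu on Ω (where Δ = ∂²/∂x² + ∂²/∂y²), one has C ∫_Ω |α(p) u(p)|² dp ≥ ∫_Ω |u(p)|² dp. -/

import Mathlib

open MeasureTheory

/-- The flat Laplacian `Δu = ∂²u/∂x² + ∂²u/∂y²` of a function on `ℝ²`, expressed through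
iterated Fréchet derivatives in the two coordinate directions. -/
noncomputable def lap2 (v : ℝ × ℝ → ℂ) (p : ℝ × ℝ) : ℂ :=
  fderiv ℝ (fun q => fderiv ℝ v q (1, 0)) p (1, 0) +
    fderiv ℝ (fun q => fderiv ℝ v q (0, 1)) p (0, 1)

/-- The Bunimovich stadium with parameter `a > 0`: the open rectangle `(0,1) × (0,a)`
together with the two open discs of radius `a/2` centered at `(0, a/2)` and `(1, a/2)`. -/
def stadium (a : ℝ) : Set (ℝ × ℝ) :=
  (Set.Ioo 0 1 ×ˢ Set.Ioo 0 a) ∪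
    {p | p.1 ^ 2 + (p.2 - a / 2) ^ 2 < (a / 2) ^ 2} ∪
    {p | (p.1 - 1) ^ 2 + (p.2 - a / 2) ^ 2 < (a / 2) ^ 2}

lemma helmholtz_add_sub_eq {w w' : ℝ → ℂ} {ν : ℝ} {l r : ℝ}
    (hw : ∀ x ∈ Set.Ioo l r, HasDerivAt w (w' x) x)
    (hw' : ∀ x ∈ Set.Ioo l r, HasDerivAt w' (-((ν : ℂ) ^ 2) * w x) x)
    {x h : ℝ} (hh : 0 ≤ h) (hl : l < x - h) (hr : x + h < r) :
    w (x + h) + w (x - h) = 2 * (Real.cos (ν * h) : ℂ) * w x := by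
  obtain ⟨S, hSd, hS0, hSodd⟩ : ∃ S : ℝ → ℝ, (∀ t, HasDerivAt S (Real.cos (ν * t)) t) ∧
      S 0 = 0 ∧ ∀ t, S (-t) = -S t := by
    refine ⟨fun t => ∫ τ in (0 : ℝ)..t, Real.cos (ν * τ), fun t => ?_, by simp, fun t => ?_⟩
    · have hc : Continuous fun τ : ℝ => Real.cos (ν * τ) := by fun_prop
      exact hc.integral_hasStrictDerivAt 0 t |>.hasDerivAt
    · have := intervalIntegral.integral_comp_neg (a := 0) (b := t) fun τ : ℝ => Real.cos (ν * τ)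
      simp only [mul_neg, Real.cos_neg, neg_zero] at this
      simp only [this]
      rw [intervalIntegral.integral_symm]
  have hSsin : ∀ t, ν * S t = Real.sin (ν * t) := by
    intro t
    have hd : ∀ t, HasDerivAt (fun t => ν * S t - Real.sin (ν * t)) 0 t := by
      intro t
      have h1 := ((hSd t).const_mul ν).sub (((hasDerivAt_id t).const_mul ν).sin)
      refine h1.congr_deriv ?_
      simp; ring
    have := is_const_of_deriv_eq_zero (fun t => (hd t).differentiableAt) (fun t => (hd t).deriv) t 0
    simp [hS0] at this
    linarith
  have key : ∀ s ∈ Set.Ioo l r, w s = w x * (Real.cos (ν * (s - x)) : ℂ) + w' x * (S (s - x) : ℂ) := by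
    intro s hs
    have hx : x ∈ Set.Ioo l r := ⟨by linarith, by linarith⟩
    let E : ℝ → ℂ := fun t => w t * (Real.cos (ν * (s - t)) : ℂ) + w' t * (S (s - t) : ℂ)
    have hE : ∀ t ∈ Set.Ioo l r, HasDerivAt E 0 t := by
      intro t ht
      have h1 : HasDerivAt (fun t : ℝ => s - t) (-1) t := by
        simpa using (hasDerivAt_id t).const_sub s
      have h2 := ((h1.const_mul ν).cos).ofReal_comp
      have h3 := (((hSd (s - t)).comp t h1)).ofReal_comp
      refine (((hw t ht).mul h2).add ((hw' t ht).mul h3)).congr_deriv ?_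
      have := hSsin (s - t)
      simp only [Function.comp]
      rw [← this]
      push_cast
      ring
    have := isOpen_Ioo.is_const_of_deriv_eq_zero (s := Set.Ioo l r) isPreconnected_Ioo
      (fun t ht => (hE t ht).differentiableAt.differentiableWithinAt)
      (fun t ht => (hE t ht).deriv) hs hx
    simpa [E, hS0] using this
  rw [key (x + h) ⟨by linarith, by linarith⟩, key (x - h) ⟨by linarith, by linarith⟩]
  have e1 : x + h - x = h := by ring
  have e2 : x - h - x = -h := by ring
  rw [e1, e2, hSodd, mul_neg, Real.cos_neg]
  push_cast
  ring

lemma integral_le_of_add_le {g : ℝ → ℝ} (hg : ContinuousOn g (Set.Icc 0 1)) (hg0 : ∀ x, 0 ≤ g x)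
    {h : ℝ} (hh : 0 < h)
    (hstep : ∀ x, h < x → x + h < 1 → g (x + h) ≤ 8 * g x + 2 * g (x - h)) (n : ℕ) (hn : 2 ≤ n)
    (hn1 : n * h ≤ 1) :
    ∫ x in (0 : ℝ)..(n * h), g x ≤ 11 ^ n * ∫ x in (0 : ℝ)..(2 * h), g x := by
  have hint : ∀ s t : ℝ, 0 ≤ s → s ≤ t → t ≤ 1 → IntervalIntegrable g volume s t := by
    intro s t hs hst ht
    exact (hg.mono (Set.Icc_subset_Icc hs ht)).intervalIntegrable_of_Icc hst
  have hmono : ∀ s t : ℝ, 0 ≤ s → s ≤ t → t ≤ 1 →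
      ∫ x in (0 : ℝ)..s, g x ≤ ∫ x in (0 : ℝ)..t, g x := by
    intro s t hs hst ht
    rw [← intervalIntegral.integral_add_adjacent_intervals (hint 0 s le_rfl hs (hst.trans ht))
      (hint s t hs hst ht)]
    have := intervalIntegral.integral_nonneg (μ := volume) hst (fun u _ => hg0 u)
    linarith
  induction n, hn using Nat.le_induction with
  | base =>
    have := intervalIntegral.integral_nonneg (μ := volume) (a := 0) (b := 2 * h) (by linarith) (fun u _ => hg0 u)
    push_cast
    nlinarith
  | succ n hn ih =>
    push_cast at hn1 ⊢
    have hn2 : (2 : ℝ) ≤ n := by exact_mod_cast hn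
    have ht : 2 * h ≤ n * h := by nlinarith
    have hth : n * h + h ≤ 1 := by linarith
    have ih := ih (by linarith)
    set t := (n : ℝ) * h
    have e : (n + 1 : ℝ) * h = t + h := by simp only [t]; ring
    rw [e, ← intervalIntegral.integral_add_adjacent_intervals (b := 2 * h)
      (hint _ _ (by linarith) (by linarith) (by linarith))
      (hint _ _ (by linarith) (by linarith) (by linarith))]
    have h1 : ∫ x in (2 * h)..(t + h), g x = ∫ x in h..t, g (x + h) := by
      rw [intervalIntegral.integral_comp_add_right]; congr 1; ring
    have i1 := hint h t (by linarith) (by linarith) (by linarith)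
    have i2 : IntervalIntegrable (fun x => g (x - h)) volume h t := by
      have := (hint 0 (t - h) (by linarith) (by linarith) (by linarith)).comp_sub_right h
      simpa using this
    have i3 : IntervalIntegrable (fun x => g (x + h)) volume h t := by
      have := (hint (2 * h) (t + h) (by linarith) (by linarith) (by linarith)).comp_add_right h
      convert this using 1 <;> ring
    have h2 : ∫ x in h..t, g (x + h) ≤ ∫ x in h..t, (8 * g x + 2 * g (x - h)) := by
      refine intervalIntegral.integral_mono_on_of_le_Ioo (by linarith) i3
        ((i1.const_mul 8).add (i2.const_mul 2)) fun x hx => ?_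
      exact hstep x hx.1 (by linarith [hx.2])
    rw [intervalIntegral.integral_add (i1.const_mul 8) (i2.const_mul 2),
      intervalIntegral.integral_const_mul, intervalIntegral.integral_const_mul,
      intervalIntegral.integral_comp_sub_right] at h2
    have h3 := hmono (t - h) t (by linarith) (by linarith) (by linarith)
    have h4 := hmono (2 * h) t (by linarith) (by linarith) (by linarith)
    have h5 : ∫ x in h..t, g x ≤ ∫ x in (0 : ℝ)..t, g x := by
      rw [← intervalIntegral.integral_add_adjacent_intervals
        (hint 0 h le_rfl hh.le (by linarith)) i1]
      have := intervalIntegral.integral_nonneg (μ := volume) hh.le (fun u _ => hg0 u)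
      linarith
    simp only [sub_self] at h2
    rw [h1, pow_succ]
    linarith

lemma ConvexOn.integral_le_of_nonneg {g : ℝ → ℝ} (hc : ConvexOn ℝ (Set.Icc 0 1) g)
    (hg : ContinuousOn g (Set.Icc 0 1)) (hg0 : ∀ x, 0 ≤ g x) {d : ℝ} (hd : 0 < d) (hd2 : d ≤ 1 / 2) :
    ∫ x in (0 : ℝ)..1, g x ≤
      (1 + d⁻¹) * ((∫ x in (0 : ℝ)..d, g x) + ∫ x in (1 - d)..1, g x) := by
  have hint : ∀ s t : ℝ, 0 ≤ s → s ≤ t → t ≤ 1 → IntervalIntegrable g volume s t := by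
    intro s t hs hst ht
    exact (hg.mono (Set.Icc_subset_Icc hs ht)).intervalIntegrable_of_Icc hst
  set A := (∫ x in (0 : ℝ)..d, g x) + ∫ x in (1 - d)..1, g x with hA
  have hA0 : 0 ≤ A := add_nonneg (intervalIntegral.integral_nonneg hd.le fun u _ => hg0 u)
    (intervalIntegral.integral_nonneg (by linarith) fun u _ => hg0 u)
  have hi0 := hint 0 d le_rfl hd.le (by linarith)
  have hi1 := hint d (1 - d) hd.le (by linarith) (by linarith)
  have hi2 := hint (1 - d) 1 (by linarith) (by linarith) le_rfl
  have hi3 : IntervalIntegrable (fun s => g (1 - s)) volume 0 d := by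
    have := (hi2.comp_sub_left 1).symm
    simpa using this
  have hpt : ∀ x ∈ Set.Icc d (1 - d), g x ≤ d⁻¹ * A := by
    intro x hx
    have : ∫ s in (0 : ℝ)..d, g x ≤ ∫ s in (0 : ℝ)..d, (g s + g (1 - s)) := by
      refine intervalIntegral.integral_mono_on hd.le (by simp) (hi0.add hi3) fun s hs => ?_
      have hseg : x ∈ segment ℝ s (1 - s) := by
        rw [segment_eq_Icc (by linarith [hs.2])]
        exact ⟨by linarith [hs.2, hx.1], by linarith [hs.2, hx.2]⟩
      have := hc.le_max_of_mem_segment (x := s) (y := 1 - s) ⟨hs.1, by linarith [hs.2]⟩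
        ⟨by linarith [hs.2], by linarith [hs.1]⟩ hseg
      exact this.trans (max_le (by linarith [hg0 (1 - s)]) (by linarith [hg0 s]))
    rw [intervalIntegral.integral_add hi0 hi3, intervalIntegral.integral_comp_sub_left] at this
    simp only [intervalIntegral.integral_const, sub_zero, smul_eq_mul] at this
    rw [inv_mul_eq_div, le_div_iff₀ hd]
    linarith
  have hmid : ∫ x in d..(1 - d), g x ≤ d⁻¹ * A := by
    have h1 : ∫ x in d..(1 - d), g x ≤ ∫ x in d..(1 - d), d⁻¹ * A :=
      intervalIntegral.integral_mono_on (by linarith) hi1 (by simp) hpt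
    rw [intervalIntegral.integral_const, smul_eq_mul] at h1
    have : 0 ≤ d⁻¹ * A := by positivity
    nlinarith
  rw [← intervalIntegral.integral_add_adjacent_intervals (hi0.trans hi1) hi2,
    ← intervalIntegral.integral_add_adjacent_intervals hi0 hi1]
  linarith

lemma exists_integral_norm_sq_le_of_deriv2_eq {h : ℝ} (hh : 0 < h) {N : ℕ} (hN : 4 ≤ N)
    (hNh : N * h = 1) :
    ∃ C > (0 : ℝ), ∀ (μ : ℝ) (w w' : ℝ → ℂ), ContinuousOn w (Set.Icc 0 1) →
      (∀ x ∈ Set.Ioo (0 : ℝ) 1, HasDerivAt w (w' x) x) →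
      (∀ x ∈ Set.Ioo (0 : ℝ) 1, HasDerivAt w' (-(μ : ℂ) * w x) x) →
      ∫ x in (0 : ℝ)..1, ‖w x‖ ^ 2 ≤ C * ((∫ x in (0 : ℝ)..(2 * h), ‖w x‖ ^ 2) +
        ∫ x in (1 - 2 * h)..1, ‖w x‖ ^ 2) := by
  have hN' : (4 : ℝ) ≤ N := by exact_mod_cast hN
  have h4 : 2 * h ≤ 1 / 2 := by nlinarith
  refine ⟨11 ^ N + (1 + (2 * h)⁻¹), by positivity, fun μ w w' hwc hw hw' => ?_⟩
  have hg : ContinuousOn (fun x => ‖w x‖ ^ 2) (Set.Icc 0 1) := by fun_prop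
  have n1 : 0 ≤ ∫ x in (0 : ℝ)..(2 * h), ‖w x‖ ^ 2 :=
    intervalIntegral.integral_nonneg (by linarith) fun u _ => by positivity
  have n2 : 0 ≤ ∫ x in (1 - 2 * h)..1, ‖w x‖ ^ 2 :=
    intervalIntegral.integral_nonneg (by linarith) fun u _ => by positivity
  have hp : (0 : ℝ) < 11 ^ N := by positivity
  have hq : (0 : ℝ) < 1 + (2 * h)⁻¹ := by positivity
  rw [add_mul]
  rcases le_total 0 μ with hμ | hμ
  · have hsq : ((Real.sqrt μ : ℝ) : ℂ) ^ 2 = μ := by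
      rw [← Complex.ofReal_pow, Real.sq_sqrt hμ]
    have := integral_le_of_add_le hg (fun x => by positivity) hh (fun x hx1 hx2 => ?_) N (by omega) hNh.le
    · rw [hNh] at this
      nlinarith
    · have e := helmholtz_add_sub_eq (ν := Real.sqrt μ) hw (by simpa only [hsq] using hw') (x := x) hh.le
        (by linarith) hx2
      have e' : w (x + h) = 2 * (Real.cos (Real.sqrt μ * h) : ℂ) * w x - w (x - h) := by
        rw [← e]; ring
      have hn : ‖w (x + h)‖ ≤ 2 * ‖w x‖ + ‖w (x - h)‖ := by
        rw [e']
        refine (norm_sub_le _ _).trans ?_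
        rw [norm_mul, norm_mul, Complex.norm_real, Real.norm_eq_abs]
        have := Real.abs_cos_le_one (Real.sqrt μ * h)
        have := norm_nonneg (w x)
        simp only [Complex.norm_ofNat]
        nlinarith
      have := norm_nonneg (w (x + h))
      nlinarith [sq_nonneg (2 * ‖w x‖ - ‖w (x - h)‖)]
  · have hc : ConvexOn ℝ (Set.Icc 0 1) fun x => ‖w x‖ ^ 2 := by
      refine convexOn_of_hasDerivWithinAt2_nonneg (convex_Icc 0 1) hg
        (f' := fun x => 2 * inner ℝ (w x) (w' x))
        (f'' := fun x => 2 * (inner ℝ (w x) (-(μ : ℂ) * w x) + inner ℝ (w' x) (w' x))) ?_ ?_ ?_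
      all_goals rw [interior_Icc]; intro x hx
      · exact (hw x hx).norm_sq.hasDerivWithinAt
      · exact (((hw x hx).inner ℝ (hw' x hx)).const_mul 2).hasDerivWithinAt
      · have : -(μ : ℂ) * w x = (-μ) • w x := by simp
        rw [this, inner_smul_right, real_inner_self_eq_norm_sq, real_inner_self_eq_norm_sq]
        have : 0 ≤ -μ := by linarith
        positivity
    have := hc.integral_le_of_nonneg hg (fun x => by positivity) (d := 2 * h) (by linarith) h4
    nlinarith

lemma continuousOn_integral_prod_mk {a : ℝ} (ha : 0 < a) {E : Type*} [NormedAddCommGroup E]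
    [NormedSpace ℝ E] {f : ℝ × ℝ → E}
    (hf : ContinuousOn f (Set.Icc 0 1 ×ˢ Set.Icc 0 a)) :
    ContinuousOn (fun x => ∫ y in (0 : ℝ)..a, f (x, y)) (Set.Icc 0 1) := by
  have hF : Continuous fun p : ℝ × ℝ => f (max 0 (min p.1 1), max 0 (min p.2 a)) := by
    refine hf.comp_continuous (by fun_prop) fun p => ?_
    simp [ha.le]
  have := intervalIntegral.continuous_parametric_intervalIntegral_of_continuous' (μ := volume)
    (f := fun x y => f (max 0 (min x 1), max 0 (min y a))) hF 0 a
  refine this.continuousOn.congr fun x hx => intervalIntegral.integral_congr fun y hy => ?_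
  rw [Set.uIcc_of_le ha.le] at hy
  simp [hx.1, hx.2, hy.1, hy.2]

lemma hasDerivAt_integral_prod_mk {a : ℝ} (ha : 0 < a) {f f' : ℝ × ℝ → ℂ}
    (hf : ContinuousOn f (Set.Icc 0 1 ×ˢ Set.Icc 0 a))
    (hf' : ContinuousOn f' (Set.Icc 0 1 ×ˢ Set.Icc 0 a))
    (hd : ∀ x ∈ Set.Ioo (0 : ℝ) 1, ∀ y ∈ Set.Icc 0 a, HasDerivAt (fun x => f (x, y)) (f' (x, y)) x)
    {x : ℝ} (hx : x ∈ Set.Ioo (0 : ℝ) 1) :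
    HasDerivAt (fun x => ∫ y in (0 : ℝ)..a, f (x, y)) (∫ y in (0 : ℝ)..a, f' (x, y)) x := by
  obtain ⟨M, hM⟩ := (isCompact_Icc.prod isCompact_Icc).exists_bound_of_continuousOn hf'
  have hi : ∀ g : ℝ × ℝ → ℂ, ContinuousOn g (Set.Icc 0 1 ×ˢ Set.Icc 0 a) → ∀ z ∈ Set.Ioo (0 : ℝ) 1,
      IntervalIntegrable (fun y => g (z, y)) volume 0 a := by
    intro g hg z hz
    refine ContinuousOn.intervalIntegrable_of_Icc ha.le ?_
    exact hg.comp (by fun_prop) fun y hy => ⟨⟨hz.1.le, hz.2.le⟩, hy⟩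
  refine (intervalIntegral.hasDerivAt_integral_of_dominated_loc_of_deriv_le
    (F := fun x y => f (x, y)) (F' := fun x y => f' (x, y)) (bound := fun _ => M)
    (Ioo_mem_nhds hx.1 hx.2) ?_ (hi f hf x hx) ?_ ?_ (by simp) ?_).2
  · filter_upwards [Ioo_mem_nhds hx.1 hx.2] with z hz
    rw [Set.uIoc_of_le ha.le]
    exact (hi f hf z hz).1.aestronglyMeasurable
  · rw [Set.uIoc_of_le ha.le]
    exact (hi f' hf' x hx).1.aestronglyMeasurable
  · refine Filter.Eventually.of_forall fun y hy z hz => hM _ ⟨⟨hz.1.le, hz.2.le⟩, ?_⟩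
    rw [Set.uIoc_of_le ha.le] at hy
    exact ⟨hy.1.le, hy.2⟩
  · refine Filter.Eventually.of_forall fun y hy z hz => hd z hz y ?_
    rw [Set.uIoc_of_le ha.le] at hy
    exact ⟨hy.1.le, hy.2⟩

lemma integral_deriv2_mul_sin {a : ℝ} (ha : 0 < a) {v v' v'' : ℝ → ℂ}
    (hv : ContinuousOn v (Set.Icc 0 a)) (hv' : ContinuousOn v' (Set.Icc 0 a))
    (hv'' : ContinuousOn v'' (Set.Icc 0 a))
    (hd : ∀ y ∈ Set.Ioo 0 a, HasDerivAt v (v' y) y)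
    (hd' : ∀ y ∈ Set.Ioo 0 a, HasDerivAt v' (v'' y) y) (h0 : v 0 = 0) (h1 : v a = 0) (n : ℤ) :
    ∫ y in (0 : ℝ)..a, v'' y * (Real.sin (n * Real.pi / a * y) : ℂ) =
      -((n * Real.pi / a : ℝ) : ℂ) ^ 2 * ∫ y in (0 : ℝ)..a, v y * (Real.sin (n * Real.pi / a * y) : ℂ) := by
  set κ : ℝ := n * Real.pi / a with hκ
  have hsc : Continuous fun y : ℝ => (Real.sin (κ * y) : ℂ) := by fun_prop
  have hcc : Continuous fun y : ℝ => (Real.cos (κ * y) : ℂ) := by fun_prop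
  have i1 : IntervalIntegrable (fun y => v'' y * (Real.sin (κ * y) : ℂ)) volume 0 a :=
    (hv''.mul hsc.continuousOn).intervalIntegrable_of_Icc ha.le
  have i2 : IntervalIntegrable (fun y => ((κ : ℂ) ^ 2) * (v y * (Real.sin (κ * y) : ℂ))) volume 0 a :=
    ((hv.mul hsc.continuousOn).const_smul ((κ : ℂ) ^ 2)).intervalIntegrable_of_Icc ha.le
  have hκa : κ * a = n * Real.pi := by rw [hκ]; field_simp
  have := intervalIntegral.integral_eq_sub_of_hasDerivAt_of_le ha.le
    (f := fun y => v' y * (Real.sin (κ * y) : ℂ) - v y * ((κ : ℂ) * (Real.cos (κ * y) : ℂ)))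
    (f' := fun y => v'' y * (Real.sin (κ * y) : ℂ) + (κ : ℂ) ^ 2 * (v y * (Real.sin (κ * y) : ℂ)))
    ((hv'.mul hsc.continuousOn).sub (hv.mul (continuousOn_const.mul hcc.continuousOn)))
    (fun y hy => ?_) (i1.add i2)
  · rw [intervalIntegral.integral_add i1 i2, intervalIntegral.integral_const_mul] at this
    simp only [hκa, h0, h1, Real.sin_int_mul_pi, mul_zero, Real.sin_zero,
      Complex.ofReal_zero, zero_mul, sub_zero] at this
    linear_combination this
  · have hid : HasDerivAt (fun y : ℝ => κ * y) κ y := by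
      simpa using (hasDerivAt_id y).const_mul κ
    have h2 := hid.sin.ofReal_comp
    have h3 := hid.cos.ofReal_comp
    refine (((hd' y hy).mul h2).sub ((hd y hy).mul (h3.const_mul (κ : ℂ)))).congr_deriv ?_
    push_cast
    ring

lemma hasSum_norm_sq_integral_mul_sin {a : ℝ} (ha : 0 < a) {v : ℝ → ℂ}
    (hv : ContinuousOn v (Set.Icc 0 a)) (h0 : v 0 = 0) :
    HasSum (fun n : ℤ => ‖∫ y in (0 : ℝ)..a, v y * (Real.sin (n * Real.pi / a * y) : ℂ)‖ ^ 2)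
      (a * ∫ y in (0 : ℝ)..a, ‖v y‖ ^ 2) := by
  let V : ℝ → ℂ := fun y => v (max 0 (min y a)) - v (max 0 (min (-y) a))
  have hVc : Continuous V := by
    refine (hv.comp_continuous (by fun_prop) fun y => ?_).sub
      (hv.comp_continuous (by fun_prop) fun y => ?_) <;> simp [ha.le]
  have hVodd : ∀ y, V (-y) = -V y := fun y => by simp [V]
  have hVv : ∀ y ∈ Set.Icc 0 a, V y = v y := fun y hy => by
    simp [V, hy.1, hy.2, h0]
  have hlt : -a < a := by linarith
  have hL2 : MemLp V 2 (volume.restrict (Set.Ioc (-a) a)) := by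
    obtain ⟨M, hM⟩ := (isCompact_Icc (a := -a) (b := a)).exists_bound_of_continuousOn hVc.continuousOn
    refine MemLp.of_bound hVc.aestronglyMeasurable M ?_
    filter_upwards [ae_restrict_mem measurableSet_Ioc] with y hy
    exact hM y ⟨hy.1.le, hy.2⟩
  have hfold : ∀ {E : Type} [NormedAddCommGroup E] [NormedSpace ℝ E] (g : ℝ → E), Continuous g →
      ∫ y in (-a)..a, g y = ∫ y in (0 : ℝ)..a, (g y + g (-y)) := by
    intro E _ _ g hg
    have hgn : Continuous fun y => g (-y) := by fun_prop
    rw [intervalIntegral.integral_add (hg.intervalIntegrable _ _) (hgn.intervalIntegrable _ _),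
      intervalIntegral.integral_comp_neg, neg_zero,
      add_comm, intervalIntegral.integral_add_adjacent_intervals (hg.intervalIntegrable _ _)
      (hg.intervalIntegrable _ _)]
  have hcoef : ∀ n : ℤ, fourierCoeffOn hlt V n =
      (-Complex.I / a) * ∫ y in (0 : ℝ)..a, v y * (Real.sin (n * Real.pi / a * y) : ℂ) := by
    intro n
    have hc : Continuous fun y : ℝ => fourier (-n) (y : AddCircle (a - -a)) • V y :=
      ((map_continuous (fourier (-n))).comp (AddCircle.continuous_mk' _)).smul hVc
    rw [fourierCoeffOn_eq_integral, hfold _ hc]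
    have : ∫ y in (0 : ℝ)..a, (fourier (-n) (y : AddCircle (a - -a)) • V y +
        fourier (-n) ((-y : ℝ) : AddCircle (a - -a)) • V (-y)) =
        ∫ y in (0 : ℝ)..a, (-2 * Complex.I) * (v y * (Real.sin (n * Real.pi / a * y) : ℂ)) := by
      refine intervalIntegral.integral_congr fun y hy => ?_
      rw [Set.uIcc_of_le ha.le] at hy
      have ha' : (a : ℂ) ≠ 0 := by exact_mod_cast ha.ne'
      have e1 : 2 * (Real.pi : ℂ) * Complex.I * ((-n : ℤ) : ℂ) * (y : ℂ) / ((a - -a : ℝ) : ℂ) =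
          -((n * Real.pi / a * y : ℝ) : ℂ) * Complex.I := by
        push_cast; field_simp; ring
      have e2 : 2 * (Real.pi : ℂ) * Complex.I * ((-n : ℤ) : ℂ) * ((-y : ℝ) : ℂ) / ((a - -a : ℝ) : ℂ) =
          ((n * Real.pi / a * y : ℝ) : ℂ) * Complex.I := by
        push_cast; field_simp; ring
      simp only [hVodd, hVv y hy, fourier_coe_apply, e1, e2, smul_eq_mul, Complex.ofReal_sin]
      have := Complex.two_sin ((n * Real.pi / a * y : ℝ) : ℂ)
      linear_combination (Complex.I * v y) * this +
        (v y * (Complex.exp (-((n * Real.pi / a * y : ℝ) : ℂ) * Complex.I) -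
          Complex.exp (((n * Real.pi / a * y : ℝ) : ℂ) * Complex.I))) * Complex.I_sq
    rw [this, intervalIntegral.integral_const_mul, Complex.real_smul]
    push_cast
    field_simp
    ring
  have hs := (hasSum_sq_fourierCoeffOn hlt hL2).mul_left (a ^ 2)
  have hterm : (fun n : ℤ => a ^ 2 * ‖fourierCoeffOn hlt V n‖ ^ 2) =
      fun n : ℤ => ‖∫ y in (0 : ℝ)..a, v y * (Real.sin (n * Real.pi / a * y) : ℂ)‖ ^ 2 := by
    funext n
    rw [hcoef, norm_mul, norm_div, norm_neg, Complex.norm_I, Complex.norm_real, Real.norm_of_nonneg ha.le]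
    field_simp
  have hsum : a ^ 2 * ((a - -a)⁻¹ • ∫ y in (-a)..a, ‖V y‖ ^ 2) = a * ∫ y in (0 : ℝ)..a, ‖v y‖ ^ 2 := by
    rw [hfold (fun y => ‖V y‖ ^ 2) (by fun_prop)]
    have : ∫ y in (0 : ℝ)..a, (‖V y‖ ^ 2 + ‖V (-y)‖ ^ 2) = ∫ y in (0 : ℝ)..a, 2 * ‖v y‖ ^ 2 := by
      refine intervalIntegral.integral_congr fun y hy => ?_
      rw [Set.uIcc_of_le ha.le] at hy
      simp only [hVodd, norm_neg, hVv y hy]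
      ring
    rw [this, intervalIntegral.integral_const_mul, smul_eq_mul]
    field_simp
    ring
  rwa [hterm, hsum] at hs

lemma ContDiffOn.hasDerivAt_slices {a : ℝ} {n : WithTop ℕ∞} (hn : 1 ≤ n) {u : ℝ × ℝ → ℂ}
    (hu : ContDiffOn ℝ n u (Set.Icc 0 1 ×ˢ Set.Icc 0 a)) :
    (∀ x ∈ Set.Ioo (0 : ℝ) 1, ∀ y ∈ Set.Icc 0 a, HasDerivAt (fun x => u (x, y))
      (fderivWithin ℝ u (Set.Icc 0 1 ×ˢ Set.Icc 0 a) (x, y) (1, 0)) x) ∧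
    (∀ x ∈ Set.Icc (0 : ℝ) 1, ∀ y ∈ Set.Ioo 0 a, HasDerivAt (fun y => u (x, y))
      (fderivWithin ℝ u (Set.Icc 0 1 ×ˢ Set.Icc 0 a) (x, y) (0, 1)) y) := by
  have hd : DifferentiableOn ℝ u (Set.Icc 0 1 ×ˢ Set.Icc 0 a) :=
    hu.differentiableOn (by intro h; simp [h] at hn)
  constructor
  · intro x hx y hy
    have hx' : x ∈ Set.Icc (0 : ℝ) 1 := ⟨hx.1.le, hx.2.le⟩
    have h1 : HasDerivWithinAt (fun x : ℝ => (x, y)) (1, 0) (Set.Icc 0 1) x :=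
      (hasDerivWithinAt_id _ _).prodMk (hasDerivWithinAt_const _ _ _)
    have hm : Set.MapsTo (fun x : ℝ => (x, y)) (Set.Icc 0 1) (Set.Icc 0 1 ×ˢ Set.Icc 0 a) :=
      fun z hz => ⟨hz, hy⟩
    exact ((hd (x, y) ⟨hx', hy⟩).hasFDerivWithinAt.comp_hasDerivWithinAt x h1 hm).hasDerivAt (Icc_mem_nhds hx.1 hx.2)
  · intro x hx y hy
    have hy' : y ∈ Set.Icc (0 : ℝ) a := ⟨hy.1.le, hy.2.le⟩
    have h1 : HasDerivWithinAt (fun y : ℝ => (x, y)) (0, 1) (Set.Icc 0 a) y :=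
      (hasDerivWithinAt_const _ _ _).prodMk (hasDerivWithinAt_id _ _)
    have hm : Set.MapsTo (fun y : ℝ => (x, y)) (Set.Icc 0 a) (Set.Icc 0 1 ×ˢ Set.Icc 0 a) :=
      fun z hz => ⟨hx, hz⟩
    exact ((hd (x, y) ⟨hx, hy'⟩).hasFDerivWithinAt.comp_hasDerivWithinAt y h1 hm).hasDerivAt (Icc_mem_nhds hy.1 hy.2)

lemma exists_rectangle_integral_norm_sq_le {a : ℝ} (ha : 0 < a) {h : ℝ} (hh : 0 < h) {N : ℕ}
    (hN : 4 ≤ N) (hNh : N * h = 1) :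
    ∃ C > (0 : ℝ), ∀ (lam : ℝ) (u : ℝ × ℝ → ℂ),
      ContDiffOn ℝ 2 u (Set.Icc 0 1 ×ˢ Set.Icc 0 a) →
      (∀ x ∈ Set.Icc (0 : ℝ) 1, u (x, 0) = 0) → (∀ x ∈ Set.Icc (0 : ℝ) 1, u (x, a) = 0) →
      (∀ p ∈ Set.Ioo (0 : ℝ) 1 ×ˢ Set.Ioo 0 a, -lap2 u p = (lam : ℂ) * u p) →
      ∫ x in (0 : ℝ)..1, ∫ y in (0 : ℝ)..a, ‖u (x, y)‖ ^ 2 ≤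
        C * ((∫ x in (0 : ℝ)..(2 * h), ∫ y in (0 : ℝ)..a, ‖u (x, y)‖ ^ 2) +
          ∫ x in (1 - 2 * h)..1, ∫ y in (0 : ℝ)..a, ‖u (x, y)‖ ^ 2) := by
  obtain ⟨C, hC, hobs⟩ := exists_integral_norm_sq_le_of_deriv2_eq hh hN hNh
  refine ⟨C, hC, fun lam u hu hu0 hua heq => ?_⟩
  have hN' : (4 : ℝ) ≤ N := by exact_mod_cast hN
  have h4 : 2 * h ≤ 1 / 2 := by nlinarith
  set K : Set (ℝ × ℝ) := Set.Icc 0 1 ×ˢ Set.Icc 0 a with hK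
  have hKd : UniqueDiffOn ℝ K :=
    (uniqueDiffOn_Icc zero_lt_one).prod (uniqueDiffOn_Icc ha)
  have huc : ContinuousOn u K := hu.continuousOn
  have hslice : ∀ {f : ℝ × ℝ → ℂ}, ContinuousOn f K → ∀ x ∈ Set.Icc (0 : ℝ) 1,
      ContinuousOn (fun y => f (x, y)) (Set.Icc 0 a) := by
    intro f hf x hx
    exact hf.comp (by fun_prop) fun y hy => ⟨hx, hy⟩
  let v₁ : ℝ × ℝ → ℂ := fun p => fderivWithin ℝ u K p (1, 0)
  let v₂ : ℝ × ℝ → ℂ := fun p => fderivWithin ℝ u K p (0, 1)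
  have hf1 : ContDiffOn ℝ 1 (fderivWithin ℝ u K) K := hu.fderivWithin hKd (by norm_num)
  have hv₁ : ContDiffOn ℝ 1 v₁ K := hf1.clm_apply contDiffOn_const
  have hv₂ : ContDiffOn ℝ 1 v₂ K := hf1.clm_apply contDiffOn_const
  let v₁₁ : ℝ × ℝ → ℂ := fun p => fderivWithin ℝ v₁ K p (1, 0)
  let v₂₂ : ℝ × ℝ → ℂ := fun p => fderivWithin ℝ v₂ K p (0, 1)
  have hv₁₁ : ContinuousOn v₁₁ K :=
    (hv₁.continuousOn_fderivWithin hKd le_rfl).clm_apply continuousOn_const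
  have hv₂₂ : ContinuousOn v₂₂ K :=
    (hv₂.continuousOn_fderivWithin hKd le_rfl).clm_apply continuousOn_const
  have hsl := hu.hasDerivAt_slices (by norm_num)
  have hsl₁ := hv₁.hasDerivAt_slices le_rfl
  have hsl₂ := hv₂.hasDerivAt_slices le_rfl
  have hlap : ∀ x ∈ Set.Ioo (0 : ℝ) 1, ∀ y ∈ Set.Ioo 0 a,
      v₁₁ (x, y) = -(lam : ℂ) * u (x, y) - v₂₂ (x, y) := by
    intro x hx y hy
    have hR : IsOpen (Set.Ioo (0 : ℝ) 1 ×ˢ Set.Ioo 0 a) := isOpen_Ioo.prod isOpen_Ioo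
    have hRK : Set.Ioo (0 : ℝ) 1 ×ˢ Set.Ioo 0 a ⊆ K :=
      Set.prod_mono Set.Ioo_subset_Icc_self Set.Ioo_subset_Icc_self
    have hnhds : ∀ q ∈ Set.Ioo (0 : ℝ) 1 ×ˢ Set.Ioo 0 a, K ∈ nhds q := fun q hq =>
      Filter.mem_of_superset (hR.mem_nhds hq) hRK
    have hp : (x, y) ∈ Set.Ioo (0 : ℝ) 1 ×ˢ Set.Ioo 0 a := ⟨hx, hy⟩
    have he : ∀ e : ℝ × ℝ, (fun q => fderiv ℝ u q e) =ᶠ[nhds (x, y)] fun q => fderivWithin ℝ u K q e := by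
      intro e
      filter_upwards [hR.mem_nhds hp] with q hq
      rw [fderivWithin_of_mem_nhds (hnhds q hq)]
    have h1 : v₁₁ (x, y) = fderiv ℝ (fun q => fderiv ℝ u q (1, 0)) (x, y) (1, 0) := by
      rw [(he _).fderiv_eq]
      simp only [v₁₁, v₁]
      rw [fderivWithin_of_mem_nhds (hnhds _ hp)]
    have h2 : v₂₂ (x, y) = fderiv ℝ (fun q => fderiv ℝ u q (0, 1)) (x, y) (0, 1) := by
      rw [(he _).fderiv_eq]
      simp only [v₂₂, v₂]
      rw [fderivWithin_of_mem_nhds (hnhds _ hp)]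
    have h3 := heq (x, y) hp
    rw [lap2, ← h1, ← h2] at h3
    linear_combination -h3
  let s : ℤ → ℝ → ℂ := fun n y => (Real.sin (n * Real.pi / a * y) : ℂ)
  have hs : ∀ n, Continuous (s n) := fun n => by simp only [s]; fun_prop
  have hsK : ∀ n, ContinuousOn (fun p : ℝ × ℝ => s n p.2) K := fun n =>
    ((hs n).comp continuous_snd).continuousOn
  let U : ℤ → ℝ → ℂ := fun n x => ∫ y in (0 : ℝ)..a, u (x, y) * s n y
  have hUc : ∀ n, ContinuousOn (U n) (Set.Icc 0 1) := fun n =>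
    continuousOn_integral_prod_mk ha (f := fun p => u p * s n p.2) (huc.mul (hsK n))
  have hode : ∀ n, ∫ x in (0 : ℝ)..1, ‖U n x‖ ^ 2 ≤ C * ((∫ x in (0 : ℝ)..(2 * h), ‖U n x‖ ^ 2) +
      ∫ x in (1 - 2 * h)..1, ‖U n x‖ ^ 2) := by
    intro n
    refine hobs (lam - (n * Real.pi / a) ^ 2) (U n) (fun x => ∫ y in (0 : ℝ)..a, v₁ (x, y) * s n y)
      (hUc n) (fun x hx => ?_) (fun x hx => ?_)
    · exact hasDerivAt_integral_prod_mk ha (f := fun p => u p * s n p.2) (f' := fun p => v₁ p * s n p.2)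
        (huc.mul (hsK n)) (hv₁.continuousOn.mul (hsK n))
        (fun x hx y hy => (hsl.1 x hx y hy).mul_const (s n y)) hx
    · have hx' : x ∈ Set.Icc (0 : ℝ) 1 := ⟨hx.1.le, hx.2.le⟩
      refine (hasDerivAt_integral_prod_mk ha (f := fun p => v₁ p * s n p.2)
        (f' := fun p => v₁₁ p * s n p.2)
        (hv₁.continuousOn.mul (hsK n)) (hv₁₁.mul (hsK n))
        (fun x hx y hy => (hsl₁.1 x hx y hy).mul_const (s n y)) hx).congr_deriv ?_
      have e1 : ∫ y in (0 : ℝ)..a, v₁₁ (x, y) * s n y =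
          ∫ y in (0 : ℝ)..a, (-(lam : ℂ) * (u (x, y) * s n y) - v₂₂ (x, y) * s n y) := by
        refine intervalIntegral.integral_congr_Ioo_of_le ha.le fun y hy => ?_
        simp only [hlap x hx y hy]
        ring
      have i1 : IntervalIntegrable (fun y => -(lam : ℂ) * (u (x, y) * s n y)) volume 0 a :=
        (continuousOn_const.mul ((hslice huc x hx').mul
          (hs n).continuousOn)).intervalIntegrable_of_Icc ha.le
      have i2 : IntervalIntegrable (fun y => v₂₂ (x, y) * s n y) volume 0 a :=
        ((hslice hv₂₂ x hx').mul (hs n).continuousOn).intervalIntegrable_of_Icc ha.le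
      rw [e1, intervalIntegral.integral_sub i1 i2, intervalIntegral.integral_const_mul,
        integral_deriv2_mul_sin ha (hslice huc x hx') (hslice hv₂.continuousOn x hx')
          (hslice hv₂₂ x hx') (hsl.2 x hx') (hsl₂.2 x hx') (hu0 x hx') (hua x hx') n]
      simp only [U, s]
      push_cast
      ring
  let m : ℝ → ℝ := fun x => ∫ y in (0 : ℝ)..a, ‖u (x, y)‖ ^ 2
  have hm : ContinuousOn m (Set.Icc 0 1) :=
    continuousOn_integral_prod_mk ha (f := fun p => ‖u p‖ ^ 2) (huc.norm.pow 2)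
  have hparseval : ∀ l r : ℝ, 0 ≤ l → l ≤ r → r ≤ 1 →
      ENNReal.ofReal (a * ∫ x in l..r, m x) = ∑' n, ENNReal.ofReal (∫ x in l..r, ‖U n x‖ ^ 2) := by
    intro l r hl hlr hr
    have hsub : Set.Icc l r ⊆ Set.Icc (0 : ℝ) 1 := Set.Icc_subset_Icc hl hr
    have hUi : ∀ n, IntegrableOn (fun x => ‖U n x‖ ^ 2) (Set.Ioc l r) := fun n =>
      (((hUc n).norm.pow 2).mono hsub).integrableOn_Icc.mono_set Set.Ioc_subset_Icc_self
    have hmi : IntegrableOn (fun x => a * m x) (Set.Ioc l r) :=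
      ((continuousOn_const.mul hm).mono hsub).integrableOn_Icc.mono_set Set.Ioc_subset_Icc_self
    have hm0 : ∀ x, 0 ≤ m x := fun x =>
      intervalIntegral.integral_nonneg ha.le fun y _ => by positivity
    rw [← intervalIntegral.integral_const_mul]
    simp only [intervalIntegral.integral_of_le hlr]
    rw [ofReal_integral_eq_lintegral_ofReal hmi
      (Filter.Eventually.of_forall fun x => mul_nonneg ha.le (hm0 x))]
    have : ∀ n, ENNReal.ofReal (∫ x in Set.Ioc l r, ‖U n x‖ ^ 2) =
        ∫⁻ x in Set.Ioc l r, ENNReal.ofReal (‖U n x‖ ^ 2) := fun n =>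
      ofReal_integral_eq_lintegral_ofReal (hUi n) (Filter.Eventually.of_forall fun x => by positivity)
    simp only [this]
    rw [← lintegral_tsum fun n => (hUi n).aestronglyMeasurable.aemeasurable.ennreal_ofReal]
    refine setLIntegral_congr_fun measurableSet_Ioc fun x hx => ?_
    have hx' := hsub (Set.Ioc_subset_Icc_self hx)
    have hsum := hasSum_norm_sq_integral_mul_sin ha (hslice huc x hx') (hu0 x hx')
    simp only [m]
    rw [← hsum.tsum_eq, ENNReal.ofReal_tsum_of_nonneg (fun n => by positivity) hsum.summable]
  have hnn : ∀ (g : ℝ → ℝ) (l r : ℝ), l ≤ r → (∀ x, 0 ≤ g x) → 0 ≤ ∫ x in l..r, g x :=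
    fun g l r hlr hg => intervalIntegral.integral_nonneg hlr fun x _ => hg x
  have hm0 : ∀ x, 0 ≤ m x := fun x => hnn _ _ _ ha.le fun y => by positivity
  have hm1 := hnn m 0 (2 * h) (by linarith) hm0
  have hm2 := hnn m (1 - 2 * h) 1 (by linarith) hm0
  have hfinal : ENNReal.ofReal (a * ∫ x in (0 : ℝ)..1, m x) ≤
      ENNReal.ofReal (a * (C * ((∫ x in (0 : ℝ)..(2 * h), m x) + ∫ x in (1 - 2 * h)..1, m x))) := by
    have e : a * (C * ((∫ x in (0 : ℝ)..(2 * h), m x) + ∫ x in (1 - 2 * h)..1, m x)) =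
        C * (a * (∫ x in (0 : ℝ)..(2 * h), m x) + a * ∫ x in (1 - 2 * h)..1, m x) := by ring
    rw [e, ENNReal.ofReal_mul hC.le, ENNReal.ofReal_add (by positivity) (by positivity),
      hparseval 0 1 le_rfl zero_le_one le_rfl,
      hparseval 0 (2 * h) le_rfl (by linarith) (by linarith),
      hparseval (1 - 2 * h) 1 (by linarith) (by linarith) le_rfl, ← ENNReal.tsum_add,
      ← ENNReal.tsum_mul_left]
    refine ENNReal.tsum_le_tsum fun n => ?_
    rw [← ENNReal.ofReal_add (hnn _ _ _ (by linarith) fun x => by positivity)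
      (hnn _ _ _ (by linarith) fun x => by positivity), ← ENNReal.ofReal_mul hC.le]
    exact ENNReal.ofReal_le_ofReal (hode n)
  rw [ENNReal.ofReal_le_ofReal_iff (by positivity)] at hfinal
  exact le_of_mul_le_mul_left hfinal ha

lemma setIntegral_rectangle_eq {a : ℝ} (ha : 0 < a) {f : ℝ × ℝ → ℝ}
    (hf : ContinuousOn f (Set.Icc 0 1 ×ˢ Set.Icc 0 a)) {l r : ℝ} (hl : 0 ≤ l) (hlr : l ≤ r)
    (hr : r ≤ 1) :
    ∫ p in Set.Ioo l r ×ˢ Set.Ioo 0 a, f p = ∫ x in l..r, ∫ y in (0 : ℝ)..a, f (x, y) := by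
  have hi : IntegrableOn f (Set.Ioo l r ×ˢ Set.Ioo 0 a) (volume.prod volume) :=
    (hf.integrableOn_compact (isCompact_Icc.prod isCompact_Icc)).mono_set
      (Set.prod_mono (fun x hx => ⟨hl.trans hx.1.le, hx.2.le.trans hr⟩) Set.Ioo_subset_Icc_self)
  rw [Measure.volume_eq_prod, setIntegral_prod _ hi]
  simp only [intervalIntegral.integral_of_le hlr, intervalIntegral.integral_of_le ha.le,
    integral_Ioc_eq_integral_Ioo]

lemma isOpen_stadium (a : ℝ) : IsOpen (stadium a) := by
  refine ((isOpen_Ioo.prod isOpen_Ioo).union ?_).union ?_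
  · exact isOpen_lt (by fun_prop) continuous_const
  · exact isOpen_lt (by fun_prop) continuous_const

lemma rectangle_subset_stadium (a : ℝ) : Set.Ioo (0 : ℝ) 1 ×ˢ Set.Ioo 0 a ⊆ stadium a :=
  fun _ hp => Or.inl (Or.inl hp)

lemma stadium_subset {a : ℝ} (ha : 0 < a) : stadium a ⊆ Set.Icc (-a) (1 + a) ×ˢ Set.Ioo 0 a := by
  have hdisc : ∀ s t : ℝ, s ^ 2 + (t - a / 2) ^ 2 < (a / 2) ^ 2 → -a ≤ s ∧ s ≤ a ∧ 0 < t ∧ t < a := by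
    intro s t h
    have hs := abs_lt_of_sq_lt_sq' (by nlinarith [sq_nonneg (t - a / 2)] : s ^ 2 < (a / 2) ^ 2)
      (by linarith)
    have ht := abs_lt_of_sq_lt_sq' (by nlinarith [sq_nonneg s] : (t - a / 2) ^ 2 < (a / 2) ^ 2)
      (by linarith)
    refine ⟨?_, ?_, ?_, ?_⟩ <;> linarith [hs.1, hs.2, ht.1, ht.2]
  rintro ⟨x, y⟩ ((⟨hx, hy⟩ | h) | h)
  · exact ⟨⟨by linarith [hx.1], by linarith [hx.2]⟩, hy⟩
  · obtain ⟨h1, h2, h3, h4⟩ := hdisc x y h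
    exact ⟨⟨h1, by linarith⟩, h3, h4⟩
  · obtain ⟨h1, h2, h3, h4⟩ := hdisc (x - 1) y h
    exact ⟨⟨by linarith, by linarith⟩, h3, h4⟩

lemma isCompact_closure_stadium {a : ℝ} (ha : 0 < a) : IsCompact (closure (stadium a)) :=
  ((Metric.isBounded_Icc _ _).prod (Metric.isBounded_Ioo _ _) |>.subset
    (stadium_subset ha)).isCompact_closure

lemma Icc_prod_subset_closure_stadium {a : ℝ} (ha : 0 < a) :
    Set.Icc (0 : ℝ) 1 ×ˢ Set.Icc 0 a ⊆ closure (stadium a) := by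
  have := closure_mono (rectangle_subset_stadium a)
  rwa [closure_prod_eq, closure_Ioo zero_ne_one, closure_Ioo ha.ne] at this

lemma exists_strips_half_le {a : ℝ} {α : ℝ × ℝ → ℝ}
    (hα : ContinuousOn α (Set.Icc 0 1 ×ˢ Set.Icc 0 a))
    (h0 : ∀ y ∈ Set.Ioo 0 a, α (0, y) = 1) (h1 : ∀ y ∈ Set.Ioo 0 a, α (1, y) = 1) :
    ∃ ε > (0 : ℝ), ∀ x ∈ Set.Icc (0 : ℝ) 1, ∀ y ∈ Set.Ioo 0 a, x < ε ∨ 1 - x < ε → 1 / 2 ≤ α (x, y) := by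
  have huc := (isCompact_Icc.prod isCompact_Icc).uniformContinuousOn_of_continuous hα
  rw [Metric.uniformContinuousOn_iff] at huc
  obtain ⟨ε, hε, hαε⟩ := huc (1 / 2) (by norm_num)
  refine ⟨ε, hε, fun x hx y hy hxε => ?_⟩
  have hy' : y ∈ Set.Icc 0 a := ⟨hy.1.le, hy.2.le⟩
  have key : ∀ z ∈ Set.Icc (0 : ℝ) 1, α (z, y) = 1 → |x - z| < ε → 1 / 2 ≤ α (x, y) := by
    intro z hz hαz hxz
    have := hαε (x, y) ⟨hx, hy'⟩ (z, y) ⟨hz, hy'⟩ (by simpa [Prod.dist_eq, Real.dist_eq, hε] using hxz)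
    rw [hαz, Real.dist_eq, abs_lt] at this
    linarith [this.1]
  rcases hxε with h | h
  · exact key 0 (by simp) (h0 y hy) (by rw [sub_zero, abs_of_nonneg hx.1]; exact h)
  · exact key 1 (by simp) (h1 y hy) (by rw [abs_sub_comm, abs_of_nonneg (by linarith [hx.2])]; exact h)

/-- **Theorem 1.3 of Burq–Zworski (no scarring on the rectangle):** for any continuous
weight `α` equal to `1` on the wings `Ω ∖ R` of the Bunimovich stadium, a fixed
proportion of the `L²` mass of every Dirichlet eigenfunction is seen by `α`, uniformly
in the eigenvalue `λ`. -/
theorem stadium_eigenfunction_no_scarring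
    (a : ℝ) (ha : 0 < a) (α : ℝ × ℝ → ℝ)
    (hαcont : ContinuousOn α (closure (stadium a)))
    (hα1 : ∀ p ∈ stadium a \ (Set.Ioo (0:ℝ) 1 ×ˢ Set.Ioo 0 a), α p = 1) :
    ∃ C > (0:ℝ), ∀ (lam : ℝ) (u : ℝ × ℝ → ℂ),
      ContDiffOn ℝ 2 u (closure (stadium a)) →
      (∀ p ∈ frontier (stadium a), u p = 0) →
      (∀ p ∈ stadium a, -lap2 u p = (lam : ℂ) * u p) →
      ∫ p in stadium a, ‖u p‖ ^ 2 ≤ C * ∫ p in stadium a, α p ^ 2 * ‖u p‖ ^ 2 := by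
  have hK := Icc_prod_subset_closure_stadium ha
  have hdisc : ∀ y ∈ Set.Ioo 0 a, (y - a / 2) ^ 2 < (a / 2) ^ 2 := fun y hy => by
    nlinarith [hy.1, hy.2, mul_pos hy.1 (sub_pos.2 hy.2)]
  obtain ⟨ε, hε, hαε⟩ := exists_strips_half_le (hαcont.mono hK)
    (fun y hy => hα1 _ ⟨Or.inl (Or.inr (by simpa using hdisc y hy)), by simp⟩)
    (fun y hy => hα1 _ ⟨Or.inr (by simpa using hdisc y hy), by simp⟩)
  obtain ⟨M, hM⟩ := exists_nat_gt (2 / ε)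
  set N : ℕ := M + 4 with hN
  have hNpos : (0 : ℝ) < N := by positivity
  set h : ℝ := 1 / N with hh
  have hh0 : 0 < h := by positivity
  have hhε : 2 * h < ε := by
    have : 2 / ε < N := by rw [hN]; push_cast; linarith
    rw [div_lt_iff₀ hε] at this
    rw [hh, mul_one_div, div_lt_iff₀ hNpos]
    linarith
  have hNh : N * h = 1 := by rw [hh]; field_simp
  have hh4 : 2 * h ≤ 1 / 2 := by
    have : (4 : ℝ) ≤ N := by rw [hN]; push_cast; linarith [(Nat.cast_nonneg M : (0 : ℝ) ≤ M)]
    nlinarith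
  obtain ⟨C, hC, hrect⟩ := exists_rectangle_integral_norm_sq_le ha hh0 (by omega : 4 ≤ N) hNh
  refine ⟨8 * C + 1, by positivity, fun lam u hu hbd heq => ?_⟩
  have hfr : ∀ x ∈ Set.Icc (0 : ℝ) 1, ∀ y ∈ Set.Icc 0 a, y ∉ Set.Ioo 0 a → u (x, y) = 0 := by
    intro x hx y hy hy'
    refine hbd _ ⟨hK ⟨hx, hy⟩, fun hin => hy' ?_⟩
    exact (stadium_subset ha (interior_subset hin)).2
  have huc : ContinuousOn u (closure (stadium a)) := hu.continuousOn
  have hcl : stadium a ⊆ closure (stadium a) := subset_closure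
  have hiu : IntegrableOn (fun p => ‖u p‖ ^ 2) (stadium a) :=
    ((huc.norm.pow 2).integrableOn_compact (isCompact_closure_stadium ha)).mono_set hcl
  have hiαu : IntegrableOn (fun p => α p ^ 2 * ‖u p‖ ^ 2) (stadium a) :=
    (((hαcont.pow 2).mul (huc.norm.pow 2)).integrableOn_compact
      (isCompact_closure_stadium ha)).mono_set hcl
  have hmain := hrect lam u (hu.mono hK) (fun x hx => hfr x hx 0 (by simp [ha.le]) (by simp))
    (fun x hx => hfr x hx a (by simp [ha.le]) (by simp))
    (fun p hp => heq p (rectangle_subset_stadium a hp))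
  have hcK : ContinuousOn (fun p => ‖u p‖ ^ 2) (Set.Icc 0 1 ×ˢ Set.Icc 0 a) := (huc.mono hK).norm.pow 2
  rw [← setIntegral_rectangle_eq ha hcK le_rfl zero_le_one le_rfl,
    ← setIntegral_rectangle_eq ha hcK le_rfl (by linarith) (by linarith),
    ← setIntegral_rectangle_eq ha hcK (by linarith) (by linarith) le_rfl] at hmain
  set I := ∫ p in stadium a, α p ^ 2 * ‖u p‖ ^ 2 with hI
  have hstrip : ∀ l r : ℝ, 0 ≤ l → r ≤ 1 → r < ε ∨ 1 - l < ε →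
      ∫ p in Set.Ioo l r ×ˢ Set.Ioo 0 a, ‖u p‖ ^ 2 ≤ 4 * I := by
    intro l r hl hr hlr
    have hsub : Set.Ioo l r ×ˢ Set.Ioo 0 a ⊆ stadium a :=
      (Set.prod_mono (Set.Ioo_subset_Ioo hl hr) subset_rfl).trans (rectangle_subset_stadium a)
    have hmeas : MeasurableSet (Set.Ioo l r ×ˢ Set.Ioo 0 a) := measurableSet_Ioo.prod measurableSet_Ioo
    calc ∫ p in Set.Ioo l r ×ˢ Set.Ioo 0 a, ‖u p‖ ^ 2
        ≤ ∫ p in Set.Ioo l r ×ˢ Set.Ioo 0 a, 4 * (α p ^ 2 * ‖u p‖ ^ 2) := by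
          refine setIntegral_mono_on (hiu.mono_set hsub) ((hiαu.mono_set hsub).const_mul 4) hmeas ?_
          rintro ⟨x, y⟩ ⟨hx, hy⟩
          have := hαε x ⟨hl.trans hx.1.le, hx.2.le.trans hr⟩ y hy
            (hlr.imp (fun h' => hx.2.trans h') fun h' => by linarith [hx.1])
          have h4 : 1 ≤ 4 * α (x, y) ^ 2 := by nlinarith
          rw [← mul_assoc]
          exact le_mul_of_one_le_left (by positivity) h4
      _ = 4 * ∫ p in Set.Ioo l r ×ˢ Set.Ioo 0 a, α p ^ 2 * ‖u p‖ ^ 2 := integral_const_mul _ _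
      _ ≤ 4 * I := by
          gcongr
          exact setIntegral_mono_set hiαu (Filter.Eventually.of_forall fun p => by positivity)
            hsub.eventuallyLE
  have hs1 := hstrip 0 (2 * h) le_rfl (by linarith) (Or.inl hhε)
  have hs2 := hstrip (1 - 2 * h) 1 (by linarith) le_rfl (Or.inr (by linarith))
  have hmeasR : MeasurableSet (Set.Ioo (0 : ℝ) 1 ×ˢ Set.Ioo 0 a) :=
    measurableSet_Ioo.prod measurableSet_Ioo
  have hmeasW := (isOpen_stadium a).measurableSet.diff hmeasR
  have hwing : ∫ p in stadium a \ (Set.Ioo (0:ℝ) 1 ×ˢ Set.Ioo 0 a), ‖u p‖ ^ 2 ≤ I := by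
    have : ∫ p in stadium a \ (Set.Ioo (0:ℝ) 1 ×ˢ Set.Ioo 0 a), ‖u p‖ ^ 2 =
        ∫ p in stadium a \ (Set.Ioo (0:ℝ) 1 ×ˢ Set.Ioo 0 a), α p ^ 2 * ‖u p‖ ^ 2 :=
      setIntegral_congr_fun hmeasW fun p hp => by simp [hα1 p hp]
    rw [this]
    exact setIntegral_mono_set hiαu (Filter.Eventually.of_forall fun p => by positivity)
      Set.sdiff_subset.eventuallyLE
  have hsplit := setIntegral_sdiff (μ := volume) hmeasR hiu (rectangle_subset_stadium a)
  have : C * ((∫ p in Set.Ioo 0 (2 * h) ×ˢ Set.Ioo 0 a, ‖u p‖ ^ 2) +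
      ∫ p in Set.Ioo (1 - 2 * h) 1 ×ˢ Set.Ioo 0 a, ‖u p‖ ^ 2) ≤ C * (4 * I + 4 * I) := by
    gcongr
  linarith
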